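/- arXiv:2101.10631 — 2 statements merged into one kernel-verified Lean document; each statement's English description precedes it below -/
import Mathlib

section
/- The Σ-protocol Σ_Blind has special soundness: let q be a prime, G a commutative group of order q with generator g, and let (u,v) and (a,b) in G × G be the common input. Suppose (U, V; e₁; z₁) and (U, V; e₂; z₂) are two accepting transcripts with the same commitment and distinct challenges e₁ ≠ e₂ in ℤ/qℤ, i.e., u^{z₁} = U·a^{e₁}, v^{z₁} = V·b^{e₁}, u^{z₂} = U·a^{e₂}, and v^{z₂} = V·b^{e₂}. Then the extracted value w = (z₁ − z₂)·(e₁ − e₂)^{-1} ∈ ℤ/qℤ is a valid witness: u^w = a and v^w = b. -/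
/-- Exponentiation of a group element by an exponent in `ZMod q`; for a group of
order `q` (so every element's order divides `q`) this is well defined as a
homomorphism in the exponent. -/
def gpow {G : Type*} [Group G] {q : ℕ} [NeZero q] (x : G) (e : ZMod q) : G :=
  x ^ e.val
section
variable {G : Type*} [Group G] {q : ℕ} [NeZero q]

theorem gpow_add (x : G) (hx : x ^ q = 1) (e f : ZMod q) :
    gpow x (e + f) = gpow x e * gpow x f := by
  rw [gpow, gpow, gpow, ← pow_add, ZMod.val_add, ← pow_eq_pow_mod _ hx]

theorem gpow_mul (x : G) (hx : x ^ q = 1) (e f : ZMod q) :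
    gpow x (e * f) = gpow (gpow x e) f := by
  rw [gpow, gpow, gpow, ← pow_mul, ZMod.val_mul, ← pow_eq_pow_mod _ hx]

theorem gpow_sub (x : G) (hx : x ^ q = 1) (e f : ZMod q) :
    gpow x (e - f) = gpow x e / gpow x f := by
  rw [eq_div_iff_mul_eq', ← gpow_add x hx, sub_add_cancel]

theorem gpow_one (x : G) (hx : x ^ q = 1) : gpow x (1 : ZMod q) = x := by
  rw [gpow, ZMod.val_one_eq_one_mod, ← pow_eq_pow_mod _ hx, pow_one]

end

/-- Two accepting equations with the same commitment and distinct challenges determine a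
discrete logarithm. -/
theorem gpow_extract_eq {G : Type*} [CommGroup G] {q : ℕ} [Fact (Nat.Prime q)]
    (hG : ∀ x : G, x ^ q = 1) {u a U : G} {e₁ e₂ z₁ z₂ : ZMod q} (hne : e₁ ≠ e₂)
    (h₁ : gpow u z₁ = U * gpow a e₁) (h₂ : gpow u z₂ = U * gpow a e₂) :
    gpow u ((z₁ - z₂) * (e₁ - e₂)⁻¹) = a := by
  rw [gpow_mul u (hG u), gpow_sub u (hG u), h₁, h₂, mul_div_mul_left_eq_div,
    ← gpow_sub a (hG a), ← gpow_mul a (hG a), mul_inv_cancel₀ (sub_ne_zero.mpr hne),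
    gpow_one a (hG a)]

/-- Special soundness of the Σ-protocol Σ_Blind. -/
theorem sigmaBlind_specialSoundness
    (q : ℕ) [Fact (Nat.Prime q)]
    (G : Type*) [CommGroup G] [Fintype G] (hG : Fintype.card G = q)
    (g : G) (hg : ∀ x : G, x ∈ Subgroup.zpowers g)
    (u v a b U V : G) (e₁ e₂ z₁ z₂ : ZMod q) (hne : e₁ ≠ e₂)
    (h1 : gpow u z₁ = U * gpow a e₁) (h2 : gpow v z₁ = V * gpow b e₁)
    (h3 : gpow u z₂ = U * gpow a e₂) (h4 : gpow v z₂ = V * gpow b e₂) :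
    gpow u ((z₁ - z₂) * (e₁ - e₂)⁻¹) = a ∧
    gpow v ((z₁ - z₂) * (e₁ - e₂)⁻¹) = b := by
  have hpow (x : G) : x ^ q = 1 := hG ▸ pow_card_eq_one
  exact ⟨gpow_extract_eq hpow hne h1 h3, gpow_extract_eq hpow hne h2 h4⟩
end

section
/- The Σ-protocol Σ_Blind is special honest-verifier zero-knowledge: let q be a prime, G a commutative group of order q with generator g, (u,v) ∈ G × G, r ∈ ℤ/qℤ, a = u^r and b = v^r. Fix any challenge e ∈ ℤ/qℤ. Then the pushforward of the uniform distribution on ℤ/qℤ under the honest-prover transcript map r' ↦ (u^{r'}, v^{r'}, e, r' + e·r) is equal to the pushforward of the uniform distribution on ℤ/qℤ under the simulator map z ↦ (u^z · a^{-e}, v^z · b^{-e}, e, z); in particular every simulated transcript satisfies the verification equations u^z = U·a^e and v^z = V·b^e. -/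
theorem gpow_add_s5 {G : Type*} [Group G] [Fintype G] {q : ℕ} [NeZero q]
    (hG : Fintype.card G = q) (x : G) (s t : ZMod q) :
    gpow x (s + t) = gpow x s * gpow x t := by
  have hx : x ^ q = 1 := hG ▸ pow_card_eq_one
  rw [gpow, gpow, gpow, ZMod.val_add, ← pow_eq_pow_mod _ hx, pow_add]

theorem gpow_mul_s5 {G : Type*} [Group G] [Fintype G] {q : ℕ} [NeZero q]
    (hG : Fintype.card G = q) (x : G) (s t : ZMod q) :
    gpow x (s * t) = gpow (gpow x s) t := by
  have hx : x ^ q = 1 := hG ▸ pow_card_eq_one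
  rw [gpow, gpow, gpow, ZMod.val_mul, ← pow_eq_pow_mod _ hx, pow_mul]

theorem gpow_zero {G : Type*} [Group G] {q : ℕ} [NeZero q] (x : G) :
    gpow x (0 : ZMod q) = 1 := by
  rw [gpow, ZMod.val_zero, pow_zero]

/-- The uniform distribution on a finite type is invariant under permutations. -/
theorem PMF.map_equiv_uniformOfFintype {α : Type*} [Fintype α] [Nonempty α] (σ : α ≃ α) :
    (PMF.uniformOfFintype α).map σ = PMF.uniformOfFintype α := by
  classical
  ext x
  rw [PMF.map_apply, tsum_eq_single (σ.symm x)]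
  · simp
  · intro y hy
    exact if_neg fun h => hy (by simp [h])

/-- Special honest-verifier zero-knowledge of the Σ-protocol Σ_Blind. -/
theorem sigmaBlind_SHVZK
    (q : ℕ) [Fact (Nat.Prime q)]
    (G : Type*) [CommGroup G] [Fintype G] (hG : Fintype.card G = q)
    (g : G) (hg : ∀ x : G, x ∈ Subgroup.zpowers g)
    (u v : G) (r : ZMod q) (a b : G)
    (ha : a = gpow u r) (hb : b = gpow v r)
    (e : ZMod q) :
    (PMF.uniformOfFintype (ZMod q)).map
        (fun r' => (gpow u r', gpow v r', e, r' + e * r)) =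
      (PMF.uniformOfFintype (ZMod q)).map
        (fun z => (gpow u z * gpow a (-e), gpow v z * gpow b (-e), e, z)) ∧
    ∀ z : ZMod q,
      gpow u z = (gpow u z * gpow a (-e)) * gpow a e ∧
      gpow v z = (gpow v z * gpow b (-e)) * gpow b e := by
  have hshift : ∀ x : G, ∀ s : ZMod q,
      gpow x (s + e * r) * gpow (gpow x r) (-e) = gpow x s := fun x s => by
    rw [← gpow_mul_s5 hG, ← gpow_add_s5 hG]
    congr 1
    ring
  have hcancel : ∀ x y : G, x = x * gpow y (-e) * gpow y e := fun x y => by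
    rw [mul_assoc, ← gpow_add_s5 hG, neg_add_cancel, gpow_zero, mul_one]
  refine ⟨?_, fun z => ⟨hcancel _ a, hcancel _ b⟩⟩
  subst ha hb
  conv_rhs => rw [← PMF.map_equiv_uniformOfFintype (Equiv.addRight (e * r)), PMF.map_comp]
  congr 1
  funext s
  simp only [Function.comp_apply, Equiv.coe_addRight, hshift]
end
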